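/- arXiv:1810.12115 — 3 statements merged into one kernel-verified Lean document; each statement's English description precedes it below -/
import Mathlib

section
/- For every nonnegative integer n and all integers p and q, the Fibonacci and Lucas numbers satisfy ∑_{j=0}^{n} C(n,j) · F_p^j · F_{p-1}^{n-j} · L_{j+q} = L_{np+q}. -/
/-- Fibonacci numbers extended to all integer indices:
`F 0 = 0`, `F 1 = 1`, `F n = F (n-1) + F (n-2)` for all `n : ℤ`
(equivalently `F (-n) = (-1)^(n-1) * F n`). -/
def fibZ (n : ℤ) : ℤ :=
  if 0 ≤ n then Nat.fib n.toNat else (-1) ^ (n.natAbs + 1) * Nat.fib n.natAbs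

/-- Lucas numbers extended to all integer indices:
`L 0 = 2`, `L 1 = 1`, `L n = L (n-1) + L (n-2)` for all `n : ℤ`
(equivalently `L (-n) = (-1)^n * L n`). -/
def lucasZ (n : ℤ) : ℤ := fibZ (n - 1) + fibZ (n + 1)

theorem fibZ_eq_fib (n : ℤ) : fibZ n = Int.fib n := by
  by_cases h : 0 ≤ n
  · simp [fibZ, Int.fib, h]
  · obtain ⟨k, rfl⟩ : ∃ k : ℕ, n = -(k : ℤ) := ⟨n.natAbs, by omega⟩
    rw [Int.fib_neg_natCast]
    simp only [fibZ, if_neg h, Int.natAbs_neg, Int.natAbs_natCast]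

theorem lucasZ_step (p m : ℤ) :
    lucasZ (p + m) = fibZ (p - 1) * lucasZ m + fibZ p * lucasZ (m + 1) := by
  simp only [lucasZ, fibZ_eq_fib]
  have h1 := Int.fib_add p (m - 1)
  have h2 := Int.fib_add p (m + 1)
  rw [show p + m - 1 = p + (m - 1) by ring, show p + m + 1 = p + (m + 1) by ring, h1, h2,
    show m - 1 + 1 = m by ring, show m + 1 - 1 = m by ring]
  ring

theorem lucas_binomial_sum (n : ℕ) (p q : ℤ) :
    ∑ j ∈ Finset.range (n + 1),
      (n.choose j : ℤ) * fibZ p ^ j * fibZ (p - 1) ^ (n - j) * lucasZ ((j : ℤ) + q)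
      = lucasZ ((n : ℤ) * p + q) := by
  induction n generalizing q with
  | zero => simp
  | succ n ih =>
    have h := Finset.sum_choose_succ_mul
      (fun i k => fibZ p ^ i * fibZ (p - 1) ^ k * lucasZ ((i : ℤ) + q)) n
    simp only [← mul_assoc] at h
    rw [h, show ((n + 1 : ℕ) : ℤ) * p + q = p + (n * p + q) by push_cast; ring, lucasZ_step,
      ← ih q, add_assoc ((n : ℤ) * p) q 1, ← ih (q + 1), Finset.mul_sum, Finset.mul_sum]
    congr 1 <;> refine Finset.sum_congr rfl fun j hj => ?_
    · have hj' : j ≤ n := by simpa [Nat.lt_succ_iff] using hj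
      rw [Nat.succ_sub hj', pow_succ]
      ring
    · rw [show ((j + 1 : ℕ) : ℤ) + q = j + (q + 1) by push_cast; ring, pow_succ]
      ring
end

section
/- Let p and q be integers and let α = (1+√5)/2. For every real number y with |y| < α^{-|p|}, the series ∑_{j=0}^{∞} L_{pj+q} y^j converges, the denominator 1 - L_p y + (-1)^p y^2 is nonzero, and ∑_{j=0}^{∞} L_{pj+q} y^j = (L_q - (-1)^q L_{p-q} y) / (1 - L_p y + (-1)^p y^2). -/
open Real in
theorem fibZ_binet (n : ℤ) :
    (fibZ n : ℝ) = (goldenRatio ^ n - goldenConj ^ n) / √5 := by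
  unfold fibZ
  split_ifs with h
  · obtain ⟨m, rfl⟩ := Int.eq_ofNat_of_zero_le h
    simp only [Int.toNat_natCast, zpow_natCast]
    push_cast
    exact Real.coe_fib_eq m
  · obtain ⟨m, hm⟩ := Int.eq_ofNat_of_zero_le (show 0 ≤ -n by omega)
    obtain rfl : n = -(m : ℤ) := by omega
    simp only [Int.natAbs_neg, Int.natAbs_natCast, zpow_neg, zpow_natCast]
    push_cast
    rw [Real.coe_fib_eq m, ← inv_pow, ← inv_pow, Real.inv_goldenRatio, Real.inv_goldenConj,
      neg_pow goldenConj, neg_pow goldenRatio]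
    ring

open Real in
theorem lucasZ_binet (n : ℤ) :
    (lucasZ n : ℝ) = goldenRatio ^ n + goldenConj ^ n := by
  have h5 : (√5 : ℝ) ≠ 0 := by positivity
  have hs : goldenRatio - goldenConj = √5 := Real.goldenRatio_sub_goldenConj
  have hp := Real.goldenRatio_mul_goldenConj
  unfold lucasZ
  push_cast
  rw [fibZ_binet, fibZ_binet, zpow_add₀ Real.goldenRatio_ne_zero, zpow_add₀ Real.goldenConj_ne_zero,
    zpow_sub₀ Real.goldenRatio_ne_zero, zpow_sub₀ Real.goldenConj_ne_zero]
  simp only [zpow_one, div_eq_mul_inv _ goldenRatio, div_eq_mul_inv _ goldenConj,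
    Real.inv_goldenRatio, Real.inv_goldenConj]
  rw [← add_div, div_eq_iff h5, ← hs]
  ring

open Real in
theorem lucas_generating_function (p q : ℤ) (y : ℝ)
    (hy : |y| < ((1 + Real.sqrt 5) / 2) ^ (-|p|)) :
    Summable (fun j : ℕ => (lucasZ (p * (j : ℤ) + q) : ℝ) * y ^ j) ∧
    1 - (lucasZ p : ℝ) * y + (-1 : ℝ) ^ p * y ^ 2 ≠ 0 ∧
    ∑' j : ℕ, (lucasZ (p * (j : ℤ) + q) : ℝ) * y ^ j
      = ((lucasZ q : ℝ) - (-1 : ℝ) ^ q * (lucasZ (p - q) : ℝ) * y) /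
        (1 - (lucasZ p : ℝ) * y + (-1 : ℝ) ^ p * y ^ 2) := by
  change |y| < goldenRatio ^ (-|p|) at hy
  have h0 := Real.goldenRatio_pos
  have hφ := Real.goldenRatio_ne_zero
  have hψ := Real.goldenConj_ne_zero
  have hM : 0 < goldenRatio ^ |p| := zpow_pos h0 _
  have hyM : goldenRatio ^ |p| * |y| < 1 := by
    rw [zpow_neg, ← one_div, lt_div_iff₀ hM] at hy
    linarith
  have key : ∀ a : ℝ, |a| ≤ goldenRatio ^ |p| → |a * y| < 1 := fun a ha => by
    rw [abs_mul]
    exact lt_of_le_of_lt (mul_le_mul_of_nonneg_right ha (abs_nonneg y)) hyM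
  have hA : |goldenRatio ^ p * y| < 1 := key _ (by
    rw [abs_of_pos (zpow_pos h0 _)]
    exact zpow_le_zpow_right₀ Real.one_lt_goldenRatio.le (le_abs_self p))
  have hB : |goldenConj ^ p * y| < 1 := key _ (by
    have : |goldenConj| = goldenRatio⁻¹ := by
      rw [Real.inv_goldenRatio, abs_of_neg Real.goldenConj_neg]
    rw [abs_zpow, this, inv_zpow, ← zpow_neg]
    exact zpow_le_zpow_right₀ Real.one_lt_goldenRatio.le (neg_le_abs p))
  have hm : ∀ n : ℤ, (-1 : ℝ) ^ n = goldenRatio ^ n * goldenConj ^ n := fun n => by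
    rw [← mul_zpow, Real.goldenRatio_mul_goldenConj]
  have nA : 1 - goldenRatio ^ p * y ≠ 0 := by have := (abs_lt.1 hA).2; linarith
  have nB : 1 - goldenConj ^ p * y ≠ 0 := by have := (abs_lt.1 hB).2; linarith
  have hden : 1 - (lucasZ p : ℝ) * y + (-1 : ℝ) ^ p * y ^ 2
      = (1 - goldenRatio ^ p * y) * (1 - goldenConj ^ p * y) := by
    rw [lucasZ_binet, hm]; ring
  have hsum := ((hasSum_geometric_of_abs_lt_one hA).mul_left (goldenRatio ^ q)).add
    ((hasSum_geometric_of_abs_lt_one hB).mul_left (goldenConj ^ q))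
  have hfun : (fun j : ℕ => (lucasZ (p * (j : ℤ) + q) : ℝ) * y ^ j) =
      fun j : ℕ => goldenRatio ^ q * (goldenRatio ^ p * y) ^ j
        + goldenConj ^ q * (goldenConj ^ p * y) ^ j := by
    funext j
    rw [lucasZ_binet, zpow_add₀ hφ, zpow_add₀ hψ, zpow_mul, zpow_mul, zpow_natCast, zpow_natCast,
      mul_pow, mul_pow]
    ring
  refine ⟨hfun ▸ hsum.summable, hden ▸ mul_ne_zero nA nB, ?_⟩
  rw [hfun, hsum.tsum_eq, hden, lucasZ_binet, lucasZ_binet, hm, zpow_sub₀ hφ, zpow_sub₀ hψ]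
  have n1 : goldenRatio ^ q ≠ 0 := zpow_ne_zero _ hφ
  have n2 : goldenConj ^ q ≠ 0 := zpow_ne_zero _ hψ
  generalize goldenRatio ^ q = a at *
  generalize goldenConj ^ q = b at *
  generalize goldenRatio ^ p = c at *
  generalize goldenConj ^ p = d at *
  have e : a * b * (c / a + d / b) = b * c + a * d := by field_simp
  rw [e, eq_div_iff (mul_ne_zero nA nB)]
  linear_combination a * (1 - d * y) * inv_mul_cancel₀ nA + b * (1 - c * y) * inv_mul_cancel₀ nB
end

section
/- For all integers p, q and r, the Lucas numbers satisfy 5 L_{p+q+r} = L_{q-1} L_r L_{p-1} + (L_{q+1} L_r + L_{q-1} L_{r-1}) L_p + L_q L_{r+1} L_{p+1}. -/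
theorem fibZ_rec (n : ℤ) : fibZ (n + 2) = fibZ (n + 1) + fibZ n := by
  rcases lt_or_ge n 0 with h | h
  · obtain ⟨k, rfl⟩ : ∃ k : ℕ, n = -(k : ℤ) - 1 := ⟨(-n - 1).toNat, by omega⟩
    rcases k with _ | _ | k
    · simp [fibZ]
    · simp [fibZ]
    · have h0 : ¬ (0 ≤ -((k + 1 + 1 : ℕ) : ℤ) - 1) := by omega
      have h1 : ¬ (0 ≤ -((k + 1 + 1 : ℕ) : ℤ) - 1 + 1) := by omega
      have h2 : ¬ (0 ≤ -((k + 1 + 1 : ℕ) : ℤ) - 1 + 2) := by omega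
      have e0 : (-((k + 1 + 1 : ℕ) : ℤ) - 1).natAbs = k + 1 + 2 := by omega
      have e1 : (-((k + 1 + 1 : ℕ) : ℤ) - 1 + 1).natAbs = k + 1 + 1 := by omega
      have e2 : (-((k + 1 + 1 : ℕ) : ℤ) - 1 + 2).natAbs = k + 1 := by omega
      simp only [fibZ, if_neg h0, if_neg h1, if_neg h2, e0, e1, e2]
      rw [Nat.fib_add_two (n := k + 1)]
      push_cast
      ring
  · obtain ⟨k, rfl⟩ := Int.eq_ofNat_of_zero_le h
    have h1 : (0 : ℤ) ≤ k + 1 := by omega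
    have h2 : (0 : ℤ) ≤ k + 2 := by omega
    have e1 : ((k : ℤ) + 1).toNat = k + 1 := by omega
    have e2 : ((k : ℤ) + 2).toNat = k + 2 := by omega
    have e0 : ((k : ℤ)).toNat = k := by omega
    simp only [fibZ, if_pos h, if_pos h1, if_pos h2, e0, e1, e2]
    rw [Nat.fib_add_two]
    push_cast
    ring

theorem seq_eq_fibZ (G : ℤ → ℤ) (hG : ∀ n, G (n + 2) = G (n + 1) + G n) (n : ℤ) :
    G n = G 0 * (fibZ (n + 1) - fibZ n) + G 1 * fibZ n := by
  suffices h : G n = G 0 * (fibZ (n + 1) - fibZ n) + G 1 * fibZ n ∧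
      G (n + 1) = G 0 * fibZ n + G 1 * fibZ (n + 1) from h.1
  induction n using Int.induction_on with
  | zero => simp [fibZ]
  | succ i ih =>
    obtain ⟨a, b⟩ := ih
    have h1 := hG i
    have h2 := fibZ_rec i
    have e : (i : ℤ) + 1 + 1 = i + 2 := by ring
    rw [e, h1, h2, a, b]
    constructor <;> ring
  | pred i ih =>
    obtain ⟨a, b⟩ := ih
    have h1 := hG (-(i : ℤ) - 1)
    have h2 := fibZ_rec (-(i : ℤ) - 1)
    have e1 : -(i : ℤ) - 1 + 1 = -i := by ring
    have e2 : -(i : ℤ) - 1 + 2 = -i + 1 := by ring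
    rw [e1, e2] at h1 h2
    rw [e1]
    rw [h2] at a b
    constructor
    · linear_combination b - a - h1
    · linear_combination a

theorem lucasZ_rec (n : ℤ) : lucasZ (n + 2) = lucasZ (n + 1) + lucasZ n := by
  have h1 := fibZ_rec (n - 1)
  have h2 := fibZ_rec (n + 1)
  unfold lucasZ
  rw [show n + 2 - 1 = n - 1 + 2 by ring, show n + 2 + 1 = n + 1 + 2 by ring,
    show n + 1 - 1 = n - 1 + 1 by ring, h1, h2]
  ring

theorem lucasZ_add (m n : ℤ) :
    lucasZ (m + n) = lucasZ m * (fibZ (n + 1) - fibZ n) + lucasZ (m + 1) * fibZ n := by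
  have := seq_eq_fibZ (fun n => lucasZ (m + n))
    (fun n => by simpa only [add_assoc] using lucasZ_rec (m + n)) n
  simpa using this

theorem lucasZ_eq (n : ℤ) : lucasZ n = 2 * fibZ (n + 1) - fibZ n := by
  have h := fibZ_rec (n - 1)
  rw [show n - 1 + 2 = n + 1 by ring, show n - 1 + 1 = n by ring] at h
  unfold lucasZ
  linarith

theorem lucasZ_succ (n : ℤ) : lucasZ (n + 1) = fibZ (n + 1) + 2 * fibZ n := by
  have h := fibZ_rec n
  rw [lucasZ_eq, show n + 1 + 1 = n + 2 by ring, h]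
  ring

theorem lucasZ_pred (n : ℤ) : lucasZ (n - 1) = 3 * fibZ n - fibZ (n + 1) := by
  have h := fibZ_rec (n - 1)
  rw [show n - 1 + 2 = n + 1 by ring, show n - 1 + 1 = n by ring] at h
  rw [lucasZ_eq, show n - 1 + 1 = n by ring]
  linarith

theorem five_lucas_triple_addition (p q r : ℤ) :
    5 * lucasZ (p + q + r) =
      lucasZ (q - 1) * lucasZ r * lucasZ (p - 1) +
        (lucasZ (q + 1) * lucasZ r + lucasZ (q - 1) * lucasZ (r - 1)) * lucasZ p +
        lucasZ q * lucasZ (r + 1) * lucasZ (p + 1) := by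
  rw [lucasZ_add (p + q) r, show p + q + 1 = (p + 1) + q by ring, lucasZ_add p q,
    lucasZ_add (p + 1) q, show p + 1 + 1 = p + 2 by ring, lucasZ_rec p]
  simp only [lucasZ_pred, lucasZ_succ]
  simp only [lucasZ_eq]
  ring
end
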